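/- Let 𝔽_q be a finite field, let B ∈ 𝔽_q[T] be nonzero, and let ω := e^{2πi/3}. Define W_d(B) := ∑_D ω^{deg(D)}, where the sum runs over all monic cube-free D ∈ 𝔽_q[T] coprime to B with deg(rad(D)) = d. Then there exist complex numbers C₀, C₁, C₂ such that for every ε > 0 there is a constant C_ε with | W_d(B) − C_{d mod 3} · q^d | ≤ C_ε · q^{(1/2 + ε)d} for all d ≥ 0. -/

import Mathlib

open Polynomial UniqueFactorizationMonoid

/-- `D` is cube-free: no monic irreducible polynomial `P` satisfies `P³ ∣ D`. -/
def Polynomial.CubeFree {Fq : Type*} [Field Fq] (D : Fq[X]) : Prop :=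
  ∀ P : Fq[X], P.Monic → Irreducible P → ¬P ^ 3 ∣ D

/-- `deg(rad D)`: the sum of the degrees of the distinct monic irreducible divisors of `D`. -/
noncomputable def Polynomial.radDeg {Fq : Type*} [Field Fq] [DecidableEq Fq] (D : Fq[X]) : ℕ :=
  ∑ P ∈ (normalizedFactors D).toFinset, P.natDegree

/-- `W_d(B) = ∑_D ω^{deg D}`, the sum over monic cube-free `D` coprime to `B` with
`deg(rad D) = d`, where `ω = e^{2πi/3}`. -/
noncomputable def cubeFreeWeightedSum {Fq : Type*} [Field Fq] [DecidableEq Fq]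
    (B : Fq[X]) (d : ℕ) : ℂ :=
  ∑ᶠ D ∈ {D : Fq[X] | D.Monic ∧ D.CubeFree ∧ IsCoprime D B ∧ D.radDeg = d},
    Complex.exp (2 * Real.pi * Complex.I / 3) ^ D.natDegree


theorem Polynomial.Monic.not_dvd_of_irreducible_of_ne {F : Type*} [Field F] {P Q : F[X]}
    (hP : P.Monic)
    (hPi : Irreducible P) (hQ : Q.Monic) (hQi : Irreducible Q) (h : P ≠ Q) : ¬ P ∣ Q :=
  fun hd ↦ h (eq_of_monic_of_associated hP hQ (hPi.associated_of_dvd hQi hd))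

section MonicPolynomials

variable (F : Type*) [Field F] [Fintype F]

theorem finite_setOf_monic_natDegree_eq (m : ℕ) :
    {p : F[X] | p.Monic ∧ p.natDegree = m}.Finite :=
  Set.finite_coe_iff.mp
    (Finite.of_equiv _ ((monicEquivDegreeLT m).trans (degreeLTEquiv F m).toEquiv).symm)

/-- The monic polynomials of degree `m` over a finite field. -/
noncomputable def monicsOfDegree (m : ℕ) : Finset F[X] :=
  (finite_setOf_monic_natDegree_eq F m).toFinset

variable {F}

@[simp]
theorem mem_monicsOfDegree {m : ℕ} {p : F[X]} :
    p ∈ monicsOfDegree F m ↔ p.Monic ∧ p.natDegree = m := by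
  simp [monicsOfDegree]

variable (F) in
theorem card_monicsOfDegree (m : ℕ) : (monicsOfDegree F m).card = Fintype.card F ^ m := by
  rw [monicsOfDegree, ← Set.ncard_eq_toFinset_card _ (finite_setOf_monic_natDegree_eq F m),
    ← Nat.card_coe_set_eq]
  refine (Nat.card_congr ((monicEquivDegreeLT m).trans (degreeLTEquiv F m).toEquiv)).trans ?_
  simp

open Classical in
variable (F) in
/-- The monic irreducible polynomials of degree at most `N` over a finite field. -/
noncomputable def primesUpTo (N : ℕ) : Finset F[X] :=
  ((Finset.range (N + 1)).biUnion (monicsOfDegree F)).filter Irreducible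

@[simp]
theorem mem_primesUpTo {N : ℕ} {p : F[X]} :
    p ∈ primesUpTo F N ↔ p.Monic ∧ Irreducible p ∧ p.natDegree ≤ N := by
  simp [primesUpTo]
  tauto

variable (F) in
theorem sum_primesUpTo_le {f : ℕ → ℝ} (hf : ∀ n, 0 ≤ f n) (N : ℕ) :
    ∑ P ∈ primesUpTo F N, f P.natDegree ≤
      ∑ m ∈ Finset.range (N + 1), (Fintype.card F : ℝ) ^ m * f m := by
  classical
  calc ∑ P ∈ primesUpTo F N, f P.natDegree
      ≤ ∑ P ∈ (Finset.range (N + 1)).biUnion (monicsOfDegree F), f P.natDegree :=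
        Finset.sum_le_sum_of_subset_of_nonneg (Finset.filter_subset _ _) fun _ _ _ ↦ hf _
    _ = ∑ m ∈ Finset.range (N + 1), ∑ P ∈ monicsOfDegree F m, f P.natDegree := by
        refine Finset.sum_biUnion fun i _ j _ hij ↦ Finset.disjoint_left.mpr fun p hi hj ↦ hij ?_
        rw [← (mem_monicsOfDegree.mp hi).2, ← (mem_monicsOfDegree.mp hj).2]
    _ = ∑ m ∈ Finset.range (N + 1), (Fintype.card F : ℝ) ^ m * f m := by
        refine Finset.sum_congr rfl fun m _ ↦ ?_
        rw [Finset.sum_congr rfl fun P hP ↦ congrArg f (mem_monicsOfDegree.mp hP).2]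
        simp [card_monicsOfDegree]

open Classical in
/-- The generating series of the monic polynomials divisible by no element of a finite set `S`
of monic irreducible polynomials. -/
theorem prod_one_sub_X_pow_mul_mk (S : Finset F[X]) (hS : ∀ P ∈ S, P.Monic ∧ Irreducible P) :
    (∏ P ∈ S, (1 - (PowerSeries.X : PowerSeries ℂ) ^ P.natDegree)) *
        PowerSeries.mk (fun m ↦ (Fintype.card F : ℂ) ^ m) =
      PowerSeries.mk fun m ↦
        (((monicsOfDegree F m).filter fun D ↦ ∀ P ∈ S, ¬ P ∣ D).card : ℂ) := by
  induction S using Finset.induction_on with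
  | empty => simp [card_monicsOfDegree]
  | insert Q S hQS ih =>
    obtain ⟨hQ, hQi⟩ := hS Q (Finset.mem_insert_self _ _)
    have hS' : ∀ P ∈ S, P.Monic ∧ Irreducible P := fun P hP ↦ hS P (Finset.mem_insert_of_mem hP)
    rw [Finset.prod_insert hQS, mul_assoc, ih hS']
    ext m
    rw [sub_mul, one_mul, map_sub, PowerSeries.coeff_X_pow_mul']
    simp only [PowerSeries.coeff_mk]
    have hsplit := Finset.card_filter_add_card_filter_not
      (s := (monicsOfDegree F m).filter fun D ↦ ∀ P ∈ S, ¬ P ∣ D) (fun D ↦ Q ∣ D)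
    rw [Finset.filter_filter, Finset.filter_filter] at hsplit
    have hnew : (monicsOfDegree F m).filter (fun D ↦ ∀ P ∈ insert Q S, ¬ P ∣ D) =
        (monicsOfDegree F m).filter (fun D ↦ (∀ P ∈ S, ¬ P ∣ D) ∧ ¬ Q ∣ D) := by
      ext D
      simp [and_comm]
    have hmul : ((monicsOfDegree F m).filter (fun D ↦ (∀ P ∈ S, ¬ P ∣ D) ∧ Q ∣ D)).card =
        if Q.natDegree ≤ m then
          ((monicsOfDegree F (m - Q.natDegree)).filter fun D ↦ ∀ P ∈ S, ¬ P ∣ D).card else 0 := by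
      split_ifs with h
      · symm
        refine Finset.card_bij (fun D _ ↦ Q * D) ?_ ?_ ?_
        · intro D hD
          simp only [Finset.mem_filter, mem_monicsOfDegree] at hD ⊢
          refine ⟨⟨hQ.mul hD.1.1, ?_⟩, fun P hP hd ↦ ?_, dvd_mul_right _ _⟩
          · rw [hQ.natDegree_mul hD.1.1]
            omega
          · rcases (hS' P hP).2.prime.dvd_or_dvd hd with h1 | h1
            · exact (hS' P hP).1.not_dvd_of_irreducible_of_ne (hS' P hP).2 hQ hQi
                (fun e ↦ hQS (e ▸ hP)) h1
            · exact hD.2 P hP h1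
        · intro D _ E _ hDE
          exact mul_left_cancel₀ hQ.ne_zero hDE
        · intro D hD
          simp only [Finset.mem_filter, mem_monicsOfDegree] at hD
          obtain ⟨⟨hD1, hD2⟩, hD3, E, rfl⟩ := hD
          have hE : E.Monic := hQ.of_mul_monic_left hD1
          refine ⟨E, ?_, rfl⟩
          simp only [Finset.mem_filter, mem_monicsOfDegree]
          rw [hQ.natDegree_mul hE] at hD2
          exact ⟨⟨hE, by omega⟩, fun P hP hd ↦ hD3 P hP (dvd_mul_of_dvd_right hd _)⟩
      · refine Finset.card_eq_zero.mpr (Finset.filter_eq_empty_iff.mpr ?_)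
        rintro D hD ⟨-, hd⟩
        rw [mem_monicsOfDegree] at hD
        exact h (hD.2 ▸ natDegree_le_of_dvd hd hD.1.ne_zero)
    rw [hnew, ← hsplit, hmul]
    split_ifs <;> push_cast <;> ring

variable (F) in
theorem X_pow_dvd_prod_primesUpTo_sub (N : ℕ) :
    (PowerSeries.X : PowerSeries ℂ) ^ (N + 1) ∣
      (∏ P ∈ primesUpTo F N, (1 - (PowerSeries.X : PowerSeries ℂ) ^ P.natDegree)) -
        (1 - PowerSeries.C (Fintype.card F : ℂ) * PowerSeries.X) := by
  classical
  have hgeom : PowerSeries.mk (fun m ↦ (Fintype.card F : ℂ) ^ m) *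
      (1 - PowerSeries.C (Fintype.card F : ℂ) * PowerSeries.X) = 1 := by
    ext n
    rw [mul_sub, mul_one, ← mul_assoc, mul_comm _ (PowerSeries.C _), map_sub]
    cases n with
    | zero => simp
    | succ n =>
      rw [PowerSeries.coeff_succ_mul_X, PowerSeries.coeff_C_mul]
      simp [PowerSeries.coeff_one, pow_succ']
  have key := prod_one_sub_X_pow_mul_mk (primesUpTo F N)
    fun P hP ↦ ⟨(mem_primesUpTo.mp hP).1, (mem_primesUpTo.mp hP).2.1⟩
  have h1 : (PowerSeries.X : PowerSeries ℂ) ^ (N + 1) ∣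
      (∏ P ∈ primesUpTo F N, (1 - (PowerSeries.X : PowerSeries ℂ) ^ P.natDegree)) *
        PowerSeries.mk (fun m ↦ (Fintype.card F : ℂ) ^ m) - 1 := by
    rw [key, PowerSeries.X_pow_dvd_iff]
    intro m hm
    rw [map_sub, PowerSeries.coeff_mk, PowerSeries.coeff_one, sub_eq_zero]
    split_ifs with h0
    · subst h0
      have : ((monicsOfDegree F 0).filter fun D ↦ ∀ P ∈ primesUpTo F N, ¬ P ∣ D) = {1} := by
        ext D
        simp only [Finset.mem_filter, mem_monicsOfDegree, Finset.mem_singleton, mem_primesUpTo]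
        constructor
        · rintro ⟨⟨h, h'⟩, -⟩
          exact h.natDegree_eq_zero.mp h'
        · rintro rfl
          exact ⟨⟨monic_one, natDegree_one⟩,
            fun P hP hd ↦ hP.2.1.not_isUnit (isUnit_of_dvd_one hd)⟩
      rw [this, Finset.card_singleton, Nat.cast_one]
    · rw [Nat.cast_eq_zero, Finset.card_eq_zero, Finset.filter_eq_empty_iff]
      intro D hD hcop
      rw [mem_monicsOfDegree] at hD
      obtain ⟨P, hP, hPi, hPD⟩ := exists_monic_irreducible_factor D
        (fun hu ↦ h0 (hD.2 ▸ natDegree_eq_zero_of_isUnit hu))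
      have := natDegree_le_of_dvd hPD hD.1.ne_zero
      exact hcop P (mem_primesUpTo.mpr ⟨hP, hPi, by omega⟩) hPD
  have h2 := h1.mul_right (1 - PowerSeries.C (Fintype.card F : ℂ) * PowerSeries.X)
  rwa [sub_mul, mul_assoc, hgeom, mul_one, one_mul] at h2

end MonicPolynomials

section CubeFree

variable {F : Type*} [Field F]

theorem Polynomial.CubeFree.of_dvd {D E : F[X]} (hE : E.CubeFree) (h : D ∣ E) : D.CubeFree :=
  fun P hP hPi hd ↦ hE P hP hPi (hd.trans h)

variable [DecidableEq F]

theorem mem_normalizedFactors_iff_of_monic {D P : F[X]} (hD : D ≠ 0) :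
    P ∈ normalizedFactors D ↔ P.Monic ∧ Irreducible P ∧ P ∣ D := by
  rw [mem_normalizedFactors_iff' hD]
  constructor
  · rintro ⟨hi, hn, hd⟩
    exact ⟨hn ▸ monic_normalize hi.ne_zero, hi, hd⟩
  · rintro ⟨hm, hi, hd⟩
    exact ⟨hi, hm.normalize_eq_self, hd⟩

theorem normalizedFactors_pow_mul {D Q : F[X]} (hD : D ≠ 0) (hQ : Q.Monic)
    (hQi : Irreducible Q) (e : ℕ) :
    normalizedFactors (Q ^ e * D) = Multiset.replicate e Q + normalizedFactors D := by
  rw [normalizedFactors_mul (pow_ne_zero _ hQ.ne_zero) hD, hQi.normalizedFactors_pow,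
    hQ.normalize_eq_self]

theorem radDeg_pow_mul {D Q : F[X]} (hD : D ≠ 0) (hQ : Q.Monic) (hQi : Irreducible Q)
    (hQD : ¬ Q ∣ D) {e : ℕ} (he : e ≠ 0) :
    (Q ^ e * D).radDeg = Q.natDegree + D.radDeg := by
  have hmem : Q ∉ (normalizedFactors D).toFinset := fun h ↦
    hQD (dvd_of_mem_normalizedFactors (Multiset.mem_toFinset.mp h))
  have : (normalizedFactors (Q ^ e * D)).toFinset = insert Q (normalizedFactors D).toFinset := by
    ext P
    simp [normalizedFactors_pow_mul hD hQ hQi, he]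
  rw [radDeg, this, Finset.sum_insert hmem, radDeg]

theorem Polynomial.CubeFree.pow_mul {D Q : F[X]} (hD : D.CubeFree) (hQ : Q.Monic)
    (hQi : Irreducible Q) (hQD : ¬ Q ∣ D) {e : ℕ} (he : e < 3) : (Q ^ e * D).CubeFree := by
  intro P hP hPi hd
  by_cases hPQ : P = Q
  · subst hPQ
    rw [show 3 = e + (2 - e + 1) by omega, pow_add,
      mul_dvd_mul_iff_left (pow_ne_zero _ hP.ne_zero), pow_succ] at hd
    exact hQD ((dvd_mul_left _ _).trans hd)
  · have hcop : IsCoprime (P ^ 3) (Q ^ e) :=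
      ((hPi.coprime_iff_not_dvd).mpr
        (hP.not_dvd_of_irreducible_of_ne hPi hQ hQi hPQ)).pow
    exact hD P hP hPi (hcop.dvd_of_dvd_mul_left hd)

/-- Euler product for the cube-free monic polynomials supported on a finite set `S` of monic
irreducible polynomials, graded by the degree of the radical. -/
theorem exists_finset_cubeFree_sum_eq_prod (w : ℂ) (S : Finset F[X])
    (hS : ∀ P ∈ S, P.Monic ∧ Irreducible P) :
    ∃ T : Finset F[X],
      (∀ D, D ∈ T ↔ D.Monic ∧ D.CubeFree ∧ ∀ P, P.Monic → Irreducible P → P ∣ D → P ∈ S) ∧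
      ∑ D ∈ T, PowerSeries.C (w ^ D.natDegree) * PowerSeries.X ^ D.radDeg =
        ∏ P ∈ S, (1 + PowerSeries.C (w ^ P.natDegree + w ^ (2 * P.natDegree)) *
          PowerSeries.X ^ P.natDegree) := by
  classical
  induction S using Finset.induction_on with
  | empty =>
    refine ⟨{1}, fun D ↦ ?_, by simp [radDeg]⟩
    rw [Finset.mem_singleton]
    constructor
    · rintro rfl
      have h1 : ∀ P : F[X], Irreducible P → ¬ P ∣ 1 :=
        fun P hPi hd ↦ hPi.not_isUnit (isUnit_of_dvd_one hd)
      exact ⟨monic_one, fun P _ hPi hd ↦ h1 P hPi ((dvd_pow_self P (by norm_num)).trans hd),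
        fun P _ hPi hd ↦ absurd hd (h1 P hPi)⟩
    · rintro ⟨hD, -, h⟩
      by_contra hne
      obtain ⟨P, hP, hPi, hPD⟩ := exists_monic_irreducible_factor D
        (fun hu ↦ hne (hD.eq_one_of_isUnit hu))
      exact absurd (h P hP hPi hPD) (Finset.notMem_empty _)
  | insert Q S hQS ih =>
    obtain ⟨hQ, hQi⟩ := hS Q (Finset.mem_insert_self _ _)
    obtain ⟨T, hT, hsum⟩ := ih fun P hP ↦ hS P (Finset.mem_insert_of_mem hP)
    have hQT : ∀ D ∈ T, ¬ Q ∣ D := fun D hD hd ↦ hQS (((hT D).mp hD).2.2 Q hQ hQi hd)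
    have hT0 : ∀ D ∈ T, D ≠ 0 := fun D hD ↦ ((hT D).mp hD).1.ne_zero
    have hinj : Set.InjOn (fun x : ℕ × F[X] ↦ Q ^ x.1 * x.2)
        (Finset.range 3 ×ˢ T : Finset (ℕ × F[X])) := by
      rintro ⟨a, D⟩ hD ⟨b, E⟩ hE h
      simp only [Finset.coe_product, Set.mem_prod, Finset.mem_coe] at hD hE h
      have hab : a = b := by
        have := congrArg (fun D ↦ (normalizedFactors D).count Q) h
        have hc : ∀ D ∈ T, (normalizedFactors D).count Q = 0 := fun D hD ↦
          Multiset.count_eq_zero.mpr fun h ↦ hQT D hD (dvd_of_mem_normalizedFactors h)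
        simpa [normalizedFactors_pow_mul, hT0 D hD.2, hT0 E hE.2, hQ, hQi, hc D hD.2,
          hc E hE.2] using this
      subst hab
      rw [mul_left_cancel₀ (pow_ne_zero _ hQ.ne_zero) h]
    refine ⟨(Finset.range 3 ×ˢ T).image fun x ↦ Q ^ x.1 * x.2, fun D ↦ ?_, ?_⟩
    · simp only [Finset.mem_image, Finset.mem_product, Finset.mem_range, Prod.exists]
      constructor
      · rintro ⟨e, E, ⟨he, hE⟩, rfl⟩
        obtain ⟨hE1, hE2, hE3⟩ := (hT E).mp hE
        refine ⟨(hQ.pow e).mul hE1, hE2.pow_mul hQ hQi (hQT E hE) he, fun P hP hPi hd ↦ ?_⟩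
        rcases hPi.prime.dvd_or_dvd hd with h | h
        · have hPQ := hPi.prime.dvd_of_dvd_pow h
          rw [Finset.mem_insert]
          by_contra! hne
          exact hP.not_dvd_of_irreducible_of_ne hPi hQ hQi hne.1 hPQ
        · exact Finset.mem_insert_of_mem (hE3 P hP hPi h)
      · rintro ⟨hD1, hD2, hD3⟩
        obtain ⟨E, hDE, hQE⟩ := (FiniteMultiplicity.of_not_isUnit hQi.not_isUnit
          hD1.ne_zero).exists_eq_pow_mul_and_not_dvd
        generalize multiplicity Q D = e at hDE
        subst hDE
        have hE : E.Monic := (hQ.pow _).of_mul_monic_left hD1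
        refine ⟨_, E, ⟨?_, (hT E).mpr ⟨hE, hD2.of_dvd (dvd_mul_left _ _), ?_⟩⟩, rfl⟩
        · by_contra! h
          exact hD2 Q hQ hQi ((pow_dvd_pow Q h).trans (dvd_mul_right _ _))
        · intro P hP hPi hd
          refine (Finset.mem_insert.mp (hD3 P hP hPi (dvd_mul_of_dvd_right hd _))).resolve_left ?_
          rintro rfl
          exact hQE hd
    · rw [Finset.sum_image hinj, Finset.sum_product, Finset.prod_insert hQS, ← hsum,
        Finset.mul_sum]
      simp only [Finset.sum_range_succ, Finset.sum_range_zero, zero_add, pow_zero, one_mul]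
      rw [← Finset.sum_add_distrib, ← Finset.sum_add_distrib]
      refine Finset.sum_congr rfl fun D hD ↦ ?_
      have hDm : D.Monic := ((hT D).mp hD).1
      have h1 := radDeg_pow_mul (hT0 D hD) hQ hQi (hQT D hD) one_ne_zero
      have h2 := radDeg_pow_mul (hT0 D hD) hQ hQi (hQT D hD) two_ne_zero
      rw [h1, h2, (hQ.pow 1).natDegree_mul hDm, (hQ.pow 2).natDegree_mul hDm, natDegree_pow,
        natDegree_pow]
      simp only [map_add, map_mul, pow_add, one_mul]
      ring

/-- The coefficients of a truncated Euler product compute `cubeFreeWeightedSum`. -/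
theorem coeff_prod_eq_cubeFreeWeightedSum [Fintype F] (B : F[X]) {d N : ℕ}
    (hd : d ≤ N) [DecidablePred fun P : F[X] ↦ ¬ P ∣ B] :
    PowerSeries.coeff d (∏ P ∈ (primesUpTo F N).filter fun P ↦ ¬ P ∣ B,
      (1 + PowerSeries.C (Complex.exp (2 * Real.pi * Complex.I / 3) ^ P.natDegree +
        Complex.exp (2 * Real.pi * Complex.I / 3) ^ (2 * P.natDegree)) *
          PowerSeries.X ^ P.natDegree)) = cubeFreeWeightedSum B d := by
  obtain ⟨T, hT, hsum⟩ := exists_finset_cubeFree_sum_eq_prod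
    (Complex.exp (2 * Real.pi * Complex.I / 3)) ((primesUpTo F N).filter fun P ↦ ¬ P ∣ B)
    (fun P hP ↦ by
      rw [Finset.mem_filter, mem_primesUpTo] at hP
      exact ⟨hP.1.1, hP.1.2.1⟩)
  have hset : {D : F[X] | D.Monic ∧ D.CubeFree ∧ IsCoprime D B ∧ D.radDeg = d} =
      (T.filter fun D ↦ D.radDeg = d : Finset F[X]) := by
    ext D
    simp only [Set.mem_ofPred_eq, Finset.coe_filter, hT, Finset.mem_filter, mem_primesUpTo]
    constructor
    · rintro ⟨h1, h2, h3, h4⟩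
      refine ⟨⟨h1, h2, fun P hP hPi hPD ↦ ⟨⟨hP, hPi, ?_⟩, fun hPB ↦ ?_⟩⟩, h4⟩
      · refine le_trans ?_ (h4.trans_le hd)
        refine Finset.single_le_sum (f := fun P : F[X] ↦ P.natDegree) (fun _ _ ↦ Nat.zero_le _) ?_
        rw [Multiset.mem_toFinset]
        exact (mem_normalizedFactors_iff_of_monic h1.ne_zero).mpr ⟨hP, hPi, hPD⟩
      · exact hPi.not_isUnit (h3.isUnit_of_dvd' hPD hPB)
    · rintro ⟨⟨h1, h2, h3⟩, h4⟩
      refine ⟨h1, h2, ?_, h4⟩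
      by_contra hcop
      have hu : ¬ IsUnit (EuclideanDomain.gcd D B) := by
        rwa [EuclideanDomain.gcd_isUnit_iff]
      obtain ⟨P, hP, hPi, hPg⟩ := exists_monic_irreducible_factor _ hu
      exact (h3 P hP hPi (hPg.trans (EuclideanDomain.gcd_dvd_left _ _))).2
        (hPg.trans (EuclideanDomain.gcd_dvd_right _ _))
  rw [cubeFreeWeightedSum, hset, finsum_mem_coe_finset, ← hsum, map_sum, Finset.sum_filter]
  refine Finset.sum_congr rfl fun D _ ↦ ?_
  rw [PowerSeries.coeff_C_mul_X_pow]
  simp only [eq_comm]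

end CubeFree

section WeightedNorm

/-- The weighted `ℓ¹` norm `∑_{k < M} |a_k| R^k` of a truncated power series. -/
noncomputable def truncNorm (R : ℝ) (M : ℕ) (f : PowerSeries ℂ) : ℝ :=
  ∑ k ∈ Finset.range M, ‖PowerSeries.coeff k f‖ * R ^ k

variable {R : ℝ} (hR : 0 ≤ R) (M : ℕ)
include hR

theorem truncNorm_nonneg (f : PowerSeries ℂ) : 0 ≤ truncNorm R M f :=
  Finset.sum_nonneg fun _ _ ↦ by positivity

theorem truncNorm_add_le (f g : PowerSeries ℂ) :
    truncNorm R M (f + g) ≤ truncNorm R M f + truncNorm R M g := by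
  rw [truncNorm, truncNorm, truncNorm, ← Finset.sum_add_distrib]
  refine Finset.sum_le_sum fun k _ ↦ ?_
  rw [← add_mul, map_add]
  gcongr
  exact norm_add_le _ _

theorem truncNorm_C_mul_X_pow_le (a : ℂ) (n : ℕ) :
    truncNorm R M (PowerSeries.C a * PowerSeries.X ^ n) ≤ ‖a‖ * R ^ n := by
  have h : ∀ k, ‖PowerSeries.coeff k (PowerSeries.C a * PowerSeries.X ^ n)‖ * R ^ k =
      if n = k then ‖a‖ * R ^ n else 0 := by
    intro k
    rw [PowerSeries.coeff_C_mul_X_pow]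
    by_cases hk : k = n
    · subst hk
      simp
    · simp [hk, Ne.symm hk]
  simp only [truncNorm, h, Finset.sum_ite_eq]
  split_ifs
  · exact le_rfl
  · positivity

theorem truncNorm_one_le : truncNorm R M 1 ≤ 1 := by
  simpa using truncNorm_C_mul_X_pow_le hR M 1 0

theorem truncNorm_one_add_add_le (a b : ℂ) (m n : ℕ) :
    truncNorm R M (1 + PowerSeries.C a * PowerSeries.X ^ m + PowerSeries.C b * PowerSeries.X ^ n) ≤
      1 + ‖a‖ * R ^ m + ‖b‖ * R ^ n :=
  (truncNorm_add_le hR M _ _).trans (add_le_add ((truncNorm_add_le hR M _ _).trans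
    (add_le_add (truncNorm_one_le hR M) (truncNorm_C_mul_X_pow_le hR M a m)))
    (truncNorm_C_mul_X_pow_le hR M b n))

theorem truncNorm_mul_le (f g : PowerSeries ℂ) :
    truncNorm R M (f * g) ≤ truncNorm R M f * truncNorm R M g := by
  have hpair : ∀ k, ‖PowerSeries.coeff k (f * g)‖ * R ^ k ≤
      ∑ p ∈ Finset.HasAntidiagonal.antidiagonal k, (‖PowerSeries.coeff p.1 f‖ * R ^ p.1) *
        (‖PowerSeries.coeff p.2 g‖ * R ^ p.2) := by
    intro k
    rw [PowerSeries.coeff_mul]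
    refine (mul_le_mul_of_nonneg_right (norm_sum_le _ _) (by positivity)).trans_eq ?_
    rw [Finset.sum_mul]
    refine Finset.sum_congr rfl fun p hp ↦ ?_
    rw [norm_mul, ← Finset.HasAntidiagonal.mem_antidiagonal.mp hp, pow_add]
    ring
  refine (Finset.sum_le_sum fun k _ ↦ hpair k).trans ?_
  have hfib : ∀ k ∈ Finset.range M, Finset.HasAntidiagonal.antidiagonal k =
      (Finset.range M ×ˢ Finset.range M).filter fun p ↦ p.1 + p.2 = k := by
    intro k hk
    ext p
    simp only [Finset.HasAntidiagonal.mem_antidiagonal, Finset.mem_filter, Finset.mem_product,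
      Finset.mem_range] at hk ⊢
    omega
  rw [Finset.sum_congr rfl fun k hk ↦ by rw [hfib k hk], truncNorm, truncNorm,
    Finset.sum_mul_sum, ← Finset.sum_product']
  exact Finset.sum_fiberwise_le_sum_of_sum_fiber_nonneg fun _ _ ↦
    Finset.sum_nonneg fun _ _ ↦ by positivity

theorem truncNorm_prod_le {ι : Type*} (s : Finset ι) (f : ι → PowerSeries ℂ) (b : ι → ℝ)
    (h : ∀ i ∈ s, truncNorm R M (f i) ≤ b i) :
    truncNorm R M (∏ i ∈ s, f i) ≤ ∏ i ∈ s, b i := by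
  classical
  induction s using Finset.induction_on with
  | empty => simpa using truncNorm_one_le hR M
  | insert i s his ih =>
    rw [Finset.prod_insert his, Finset.prod_insert his]
    have hi := h i (Finset.mem_insert_self _ _)
    exact (truncNorm_mul_le hR M _ _).trans (mul_le_mul hi
      (ih fun j hj ↦ h j (Finset.mem_insert_of_mem hj)) (truncNorm_nonneg hR M _)
      ((truncNorm_nonneg hR M _).trans hi))

end WeightedNorm

/-- Convolving an absolutely convergent sequence with a bounded `3`-periodic multiple of a geometric
progression. -/
theorem norm_convolution_sub_le {g c : ℕ → ℂ} (hc : ∀ n, ‖c n‖ ≤ 1)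
    (hper : ∀ n, c (n + 3) = c n) {q R : ℝ} (hR : 0 < R) (hq : 0 < q) (hqR : 1 ≤ q * R)
    (hg : Summable fun k ↦ ‖g k‖ * R ^ k) (d : ℕ) :
    ‖∑ k ∈ Finset.range (d + 1), g k * (c (d - k) * (q : ℂ) ^ (d - k)) -
        (∑' k, g k * ((q : ℂ)⁻¹ ^ k * c (d % 3 + 2 * k))) * (q : ℂ) ^ d‖ ≤
      (∑' k, ‖g k‖ * R ^ k) * R⁻¹ ^ d := by
  have hper' : ∀ m n, c (n + 3 * m) = c n := by
    intro m
    induction m with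
    | zero => simp
    | succ m ih => intro n; rw [mul_add, ← add_assoc, mul_one, hper, ih]
  have hqi : q⁻¹ ≤ R := by
    rw [inv_le_iff_one_le_mul₀ hq]
    linarith
  have hterm : ∀ k, ‖g k * ((q : ℂ)⁻¹ ^ k * c (d % 3 + 2 * k))‖ ≤ ‖g k‖ * q⁻¹ ^ k := by
    intro k
    rw [norm_mul, norm_mul, norm_pow, norm_inv, Complex.norm_real, Real.norm_of_nonneg hq.le]
    have := hc (d % 3 + 2 * k)
    gcongr
    exact mul_le_of_le_one_right (by positivity) this
  have hsumg : Summable fun k ↦ ‖g k‖ * q⁻¹ ^ k :=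
    hg.of_nonneg_of_le (fun k ↦ by positivity) fun k ↦ by gcongr
  have hsum : Summable fun k ↦ g k * ((q : ℂ)⁻¹ ^ k * c (d % 3 + 2 * k)) :=
    Summable.of_norm_bounded hsumg hterm
  have hqC : (q : ℂ) ≠ 0 := by exact_mod_cast hq.ne'
  have hfin : ∑ k ∈ Finset.range (d + 1), g k * (c (d - k) * (q : ℂ) ^ (d - k)) =
      (∑ k ∈ Finset.range (d + 1), g k * ((q : ℂ)⁻¹ ^ k * c (d % 3 + 2 * k))) * (q : ℂ) ^ d := by
    rw [Finset.sum_mul]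
    refine Finset.sum_congr rfl fun k hk ↦ ?_
    have hkd : k ≤ d := Nat.lt_succ_iff.mp (Finset.mem_range.mp hk)
    have h1 : c (d - k) = c (d % 3 + 2 * k) := by
      rw [← hper' (d / 3) (d % 3 + 2 * k), ← hper' k (d - k)]
      congr 1
      omega
    have h2 : (q : ℂ) ^ d = (q : ℂ) ^ (d - k) * (q : ℂ) ^ k := by
      rw [← pow_add, Nat.sub_add_cancel hkd]
    rw [h1, h2, inv_pow]
    field_simp
  rw [hfin, ← hsum.sum_add_tsum_nat_add (d + 1), ← sub_mul, sub_add_cancel_left, norm_mul,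
    norm_neg, norm_pow, Complex.norm_real, Real.norm_of_nonneg hq.le]
  have htail : ‖∑' k, g (k + (d + 1)) * ((q : ℂ)⁻¹ ^ (k + (d + 1)) *
      c (d % 3 + 2 * (k + (d + 1))))‖ ≤ ∑' k, ‖g k‖ * R ^ k * (q⁻¹ * R⁻¹) ^ d := by
    have hg' := hg.mul_right ((q⁻¹ * R⁻¹) ^ d)
    refine (tsum_of_norm_bounded (((summable_nat_add_iff (d + 1)).mpr hg').hasSum)
      fun k ↦ (hterm (k + (d + 1))).trans ?_).trans ?_
    · rw [mul_assoc]
      gcongr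
      have e : R ^ (k + (d + 1)) * (q⁻¹ * R⁻¹) ^ d = R ^ k * (q⁻¹ ^ d * R) := by
        rw [mul_pow, inv_pow R, pow_add, pow_succ]
        field_simp
      rw [e, pow_add, pow_succ]
      gcongr
    · rw [← hg'.sum_add_tsum_nat_add (d + 1)]
      exact le_add_of_nonneg_left (Finset.sum_nonneg fun _ _ ↦ by positivity)
  calc _ ≤ (∑' k, ‖g k‖ * R ^ k * (q⁻¹ * R⁻¹) ^ d) * q ^ d := by gcongr
    _ = _ := by
      rw [tsum_mul_right, mul_assoc, ← mul_pow]
      congr 2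
      field_simp

section GeneratingSeries

theorem rescale_prod_one_sub_X_pow {F : Type*} [Field F] (w : ℂ) (S : Finset F[X]) :
    PowerSeries.rescale w (∏ P ∈ S, (1 - (PowerSeries.X : PowerSeries ℂ) ^ P.natDegree)) =
      ∏ P ∈ S, (1 - PowerSeries.C (w ^ P.natDegree) * PowerSeries.X ^ P.natDegree) := by
  simp [map_prod, PowerSeries.rescale_X, mul_pow]

theorem X_pow_dvd_rescale_prod_primesUpTo_sub (F : Type*) [Field F] [Fintype F] (w : ℂ) (N : ℕ) :
    (PowerSeries.X : PowerSeries ℂ) ^ (N + 1) ∣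
      (∏ P ∈ primesUpTo F N,
        (1 - PowerSeries.C (w ^ P.natDegree) * PowerSeries.X ^ P.natDegree)) -
        (1 - PowerSeries.C (w * Fintype.card F) * PowerSeries.X) := by
  have h := map_dvd (PowerSeries.rescale w) (X_pow_dvd_prod_primesUpTo_sub F N)
  rw [map_pow, PowerSeries.rescale_X, map_sub, rescale_prod_one_sub_X_pow] at h
  have h' : PowerSeries.rescale w (1 - PowerSeries.C (Fintype.card F : ℂ) * PowerSeries.X) =
      1 - PowerSeries.C (w * Fintype.card F) * PowerSeries.X := by
    ext n
    simp only [PowerSeries.coeff_rescale, map_sub, PowerSeries.coeff_C_mul, PowerSeries.coeff_X,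
      PowerSeries.coeff_one]
    rcases n with _ | _ | n <;> simp
  rw [h'] at h
  exact (Dvd.intro_left _ (mul_pow _ _ _).symm).trans h

open Classical in
/-- The local factor at `P` of the generating series of `cubeFreeWeightedSum B` after division by
the two zeta functions carrying its poles. -/
noncomputable def reducedFactor {F : Type*} [Field F] (w : ℂ) (B P : F[X]) : PowerSeries ℂ :=
  if P ∣ B then
    1 + PowerSeries.C (-(w ^ P.natDegree + w ^ (2 * P.natDegree))) * PowerSeries.X ^ P.natDegree +
      PowerSeries.C 1 * PowerSeries.X ^ (2 * P.natDegree)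
  else
    1 + PowerSeries.C (1 - (w ^ P.natDegree + w ^ (2 * P.natDegree)) ^ 2) *
        PowerSeries.X ^ (2 * P.natDegree) +
      PowerSeries.C (w ^ P.natDegree + w ^ (2 * P.natDegree)) *
        PowerSeries.X ^ (3 * P.natDegree)

open Classical in
theorem reducedFactor_eq {F : Type*} [Field F] {w : ℂ} (hw : w ^ 3 = 1) (B P : F[X]) :
    reducedFactor w B P =
      (1 - PowerSeries.C (w ^ P.natDegree) * PowerSeries.X ^ P.natDegree) *
      (1 - PowerSeries.C ((w ^ 2) ^ P.natDegree) * PowerSeries.X ^ P.natDegree) *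
      (if ¬ P ∣ B then 1 + PowerSeries.C (w ^ P.natDegree + w ^ (2 * P.natDegree)) *
          PowerSeries.X ^ P.natDegree else 1) := by
  rw [reducedFactor]
  generalize P.natDegree = n
  have h3 : PowerSeries.C (w ^ n) ^ 3 = 1 := by
    rw [← map_pow, ← pow_mul, mul_comm, pow_mul, hw, one_pow, map_one]
  have h2 : ∀ (x : PowerSeries ℂ) m, x ^ (m * n) = (x ^ n) ^ m := fun x m ↦ by
    rw [mul_comm, pow_mul]
  have h2' : ∀ m, w ^ (m * n) = (w ^ n) ^ m := fun m ↦ by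
    rw [mul_comm, pow_mul]
  rw [← pow_mul]
  simp only [ite_not, h2, h2', map_add, map_sub, map_neg, map_one, map_pow (PowerSeries.C) _ 2]
  generalize PowerSeries.C (w ^ n) = a at *
  generalize (PowerSeries.X : PowerSeries ℂ) ^ n = x
  split_ifs
  · linear_combination -x ^ 2 * h3
  · linear_combination -(x ^ 2 + (a + a ^ 2) * x ^ 3) * h3

theorem norm_pow_add_pow_le {w : ℂ} (hw : ‖w‖ = 1) (m n : ℕ) : ‖w ^ m + w ^ n‖ ≤ 2 :=
  (norm_add_le _ _).trans (by norm_num [hw])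

theorem truncNorm_reducedFactor_le {F : Type*} [Field F] {w : ℂ} (hw : ‖w‖ = 1) {R : ℝ}
    (hR : 0 ≤ R) (hR1 : R ≤ 1) (M : ℕ) (B P : F[X]) [Decidable (P ∣ B)] :
    truncNorm R M (reducedFactor w B P) ≤
      (if P ∣ B then 4 else 1) * Real.exp (7 * R ^ (2 * P.natDegree)) := by
  have hs := norm_pow_add_pow_le hw P.natDegree (2 * P.natDegree)
  have hpow : ∀ n, R ^ n ≤ 1 := fun n ↦ pow_le_one₀ hR hR1
  have hpow0 : ∀ n, 0 ≤ R ^ n := fun n ↦ pow_nonneg hR n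
  rw [reducedFactor]
  split_ifs
  · refine (truncNorm_one_add_add_le hR M _ _ _ _).trans ?_
    have h1 : 1 ≤ Real.exp (7 * R ^ (2 * P.natDegree)) := Real.one_le_exp (by positivity)
    rw [norm_neg, norm_one]
    nlinarith [mul_le_mul hs (hpow P.natDegree) (hpow0 _) zero_le_two, hpow (2 * P.natDegree)]
  · refine (truncNorm_one_add_add_le hR M _ _ _ _).trans ?_
    have h1 : ‖1 - (w ^ P.natDegree + w ^ (2 * P.natDegree)) ^ 2‖ ≤ 5 := by
      refine (norm_sub_le _ _).trans ?_
      rw [norm_one, norm_pow]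
      nlinarith [norm_nonneg (w ^ P.natDegree + w ^ (2 * P.natDegree))]
    have h2 : R ^ (3 * P.natDegree) ≤ R ^ (2 * P.natDegree) :=
      pow_le_pow_of_le_one hR hR1 (by omega)
    have h3 := Real.add_one_le_exp (7 * R ^ (2 * P.natDegree))
    nlinarith [mul_le_mul_of_nonneg_right h1 (hpow0 (2 * P.natDegree)),
      mul_le_mul hs h2 (hpow0 _) zero_le_two]

theorem exists_truncNorm_prod_reducedFactor_le {F : Type*} [Field F] [Fintype F] {w : ℂ}
    (hw : ‖w‖ = 1) {B : F[X]} (hB : B ≠ 0) {R : ℝ} (hR : 0 ≤ R) (hR1 : R ≤ 1)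
    (hqR : Fintype.card F * R ^ 2 < 1) :
    ∃ c : ℝ, ∀ M N, truncNorm R M (∏ P ∈ primesUpTo F N, reducedFactor w B P) ≤ c := by
  classical
  refine ⟨4 ^ (normalizedFactors B).toFinset.card *
    Real.exp (7 * (1 - Fintype.card F * R ^ 2)⁻¹), fun M N ↦ ?_⟩
  refine (truncNorm_prod_le hR M _ _ _
    fun P _ ↦ truncNorm_reducedFactor_le hw hR hR1 M B P).trans ?_
  rw [Finset.prod_mul_distrib]
  refine mul_le_mul ?_ ?_ (Finset.prod_nonneg fun _ _ ↦ (Real.exp_pos _).le) (by positivity)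
  · rw [← Finset.prod_filter, Finset.prod_const]
    refine pow_le_pow_right₀ (by norm_num) (Finset.card_le_card fun P hP ↦ ?_)
    rw [Finset.mem_filter, mem_primesUpTo] at hP
    exact Multiset.mem_toFinset.mpr
      ((mem_normalizedFactors_iff_of_monic hB).mpr ⟨hP.1.1, hP.1.2.1, hP.2⟩)
  · rw [← Real.exp_sum, ← Finset.mul_sum]
    gcongr
    refine (sum_primesUpTo_le F (f := fun n ↦ R ^ (2 * n)) (fun n ↦ by positivity) N).trans ?_
    simp only [pow_mul, ← mul_pow]
    rw [← tsum_geometric_of_lt_one (by positivity) hqR]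
    exact (summable_geometric_of_lt_one (by positivity) hqR).sum_le_tsum _
      fun _ _ ↦ by positivity

/-- The generating series of `cubeFreeWeightedSum B` times `1 + qX + q²X²`. -/
noncomputable def reducedSeries {F : Type*} [Field F] [Fintype F] [DecidableEq F] (B : F[X]) :
    PowerSeries ℂ :=
  PowerSeries.mk (cubeFreeWeightedSum B) *
    (1 + PowerSeries.C (Fintype.card F : ℂ) * PowerSeries.X +
      PowerSeries.C ((Fintype.card F : ℂ) ^ 2) * PowerSeries.X ^ 2)

theorem exp_two_pi_I_div_three_isPrimitiveRoot :
    IsPrimitiveRoot (Complex.exp (2 * Real.pi * Complex.I / 3)) 3 := by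
  exact_mod_cast Complex.isPrimitiveRoot_exp 3 (by norm_num)

theorem coeff_reducedSeries {F : Type*} [Field F] [Fintype F] [DecidableEq F] (B : F[X])
    {k N : ℕ} (hk : k ≤ N) :
    PowerSeries.coeff k (reducedSeries B) =
      PowerSeries.coeff k (∏ P ∈ primesUpTo F N,
        reducedFactor (Complex.exp (2 * Real.pi * Complex.I / 3)) B P) := by
  classical
  have hroot := exp_two_pi_I_div_three_isPrimitiveRoot
  have hcoeff := fun d (hd : d ≤ N) ↦ coeff_prod_eq_cubeFreeWeightedSum B hd
  set w := Complex.exp (2 * Real.pi * Complex.I / 3)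
  have hw3 : w ^ 3 = 1 := hroot.pow_eq_one
  have hw2 : 1 + w + w ^ 2 = 0 := by
    simpa [Finset.sum_range_succ] using hroot.geom_sum_eq_zero (by norm_num)
  rw [Finset.prod_congr rfl fun P _ ↦ reducedFactor_eq hw3 B P, Finset.prod_mul_distrib,
    Finset.prod_mul_distrib, ← Finset.prod_filter]
  set q : ℂ := (Fintype.card F : ℂ)
  set H : PowerSeries ℂ := ∏ P ∈ (primesUpTo F N).filter fun P ↦ ¬ P ∣ B,
    (1 + PowerSeries.C (w ^ P.natDegree + w ^ (2 * P.natDegree)) * PowerSeries.X ^ P.natDegree)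
  have h1 := X_pow_dvd_rescale_prod_primesUpTo_sub F w N
  have h2 := X_pow_dvd_rescale_prod_primesUpTo_sub F (w ^ 2) N
  set Z₁ := ∏ P ∈ primesUpTo F N,
    (1 - PowerSeries.C (w ^ P.natDegree) * PowerSeries.X ^ P.natDegree)
  set Z₂ := ∏ P ∈ primesUpTo F N,
    (1 - PowerSeries.C ((w ^ 2) ^ P.natDegree) * PowerSeries.X ^ P.natDegree)
  have hH : (PowerSeries.X : PowerSeries ℂ) ^ (N + 1) ∣
      PowerSeries.mk (cubeFreeWeightedSum B) - H := by
    rw [PowerSeries.X_pow_dvd_iff]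
    intro m hm
    rw [map_sub, PowerSeries.coeff_mk, hcoeff m (Nat.lt_succ_iff.mp hm), sub_self]
  have hw2' : 1 + PowerSeries.C w + PowerSeries.C w ^ 2 = 0 := by
    rw [← map_pow, ← map_one PowerSeries.C, ← map_add, ← map_add, hw2, map_zero]
  have hw3' : PowerSeries.C w ^ 3 = 1 := by
    rw [← map_pow, hw3, map_one]
  have hquad : (1 - PowerSeries.C (w * q) * PowerSeries.X) *
      (1 - PowerSeries.C (w ^ 2 * q) * PowerSeries.X) =
        1 + PowerSeries.C q * PowerSeries.X + PowerSeries.C (q ^ 2) * PowerSeries.X ^ 2 := by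
    simp only [map_mul, map_pow]
    linear_combination (-PowerSeries.C q * PowerSeries.X) * hw2' +
      PowerSeries.C q ^ 2 * PowerSeries.X ^ 2 * hw3'
  have hdvd : (PowerSeries.X : PowerSeries ℂ) ^ (N + 1) ∣ reducedSeries B - Z₁ * Z₂ * H := by
    have e : reducedSeries B - Z₁ * Z₂ * H =
        (PowerSeries.mk (cubeFreeWeightedSum B) - H) *
          (1 + PowerSeries.C q * PowerSeries.X + PowerSeries.C (q ^ 2) * PowerSeries.X ^ 2) -
        (Z₁ - (1 - PowerSeries.C (w * q) * PowerSeries.X)) * (Z₂ * H) -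
        (Z₂ - (1 - PowerSeries.C (w ^ 2 * q) * PowerSeries.X)) *
          ((1 - PowerSeries.C (w * q) * PowerSeries.X) * H) := by
      rw [reducedSeries]
      linear_combination -H * hquad
    rw [e]
    exact ((hH.mul_right _).sub (h1.mul_right _)).sub (h2.mul_right _)
  have := PowerSeries.X_pow_dvd_iff.mp hdvd k (Nat.lt_succ_iff.mpr hk)
  rwa [map_sub, sub_eq_zero] at this

theorem summable_norm_coeff_reducedSeries {F : Type*} [Field F] [Fintype F] [DecidableEq F]
    {B : F[X]} (hB : B ≠ 0) {R : ℝ} (hR : 0 ≤ R) (hR1 : R ≤ 1)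
    (hqR : Fintype.card F * R ^ 2 < 1) :
    Summable fun k ↦ ‖PowerSeries.coeff k (reducedSeries B)‖ * R ^ k := by
  obtain ⟨c, hc⟩ := exists_truncNorm_prod_reducedFactor_le
    (exp_two_pi_I_div_three_isPrimitiveRoot.norm'_eq_one (by norm_num)) hB hR hR1 hqR
  refine summable_of_sum_range_le (c := c) (fun _ ↦ by positivity) fun M ↦ ?_
  refine le_trans (Finset.sum_le_sum fun k hk ↦ ?_) (hc M M)
  rw [coeff_reducedSeries B (Finset.mem_range.mp hk).le]

/-- The coefficients of `1 / (1 + X + X²)`. -/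
def invCyclotomicThreeCoeff (n : ℕ) : ℂ :=
  if n % 3 = 0 then 1 else if n % 3 = 1 then -1 else 0

theorem quadratic_mul_mk_invCyclotomicThreeCoeff (q : ℂ) :
    (1 + PowerSeries.C q * PowerSeries.X + PowerSeries.C (q ^ 2) * PowerSeries.X ^ 2) *
      PowerSeries.mk (fun m ↦ invCyclotomicThreeCoeff m * q ^ m) = 1 := by
  ext n
  rw [add_mul, add_mul, one_mul, map_add, map_add, mul_assoc, mul_assoc, PowerSeries.coeff_C_mul,
    PowerSeries.coeff_C_mul, PowerSeries.coeff_X_pow_mul']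
  rcases n with _ | _ | n
  · simp [invCyclotomicThreeCoeff]
  · simp [invCyclotomicThreeCoeff, PowerSeries.coeff_succ_X_mul, PowerSeries.coeff_one]
  · have h : invCyclotomicThreeCoeff (n + 2) + invCyclotomicThreeCoeff (n + 1) +
        invCyclotomicThreeCoeff n = 0 := by
      have : n % 3 = 0 ∨ n % 3 = 1 ∨ n % 3 = 2 := by omega
      rcases this with h | h | h <;> simp [invCyclotomicThreeCoeff, Nat.add_mod, h]
    simp [PowerSeries.coeff_succ_X_mul, PowerSeries.coeff_one]
    linear_combination q ^ (n + 2) * h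

theorem cubeFreeWeightedSum_eq_sum {F : Type*} [Field F] [Fintype F] [DecidableEq F]
    (B : F[X]) (d : ℕ) :
    cubeFreeWeightedSum B d = ∑ k ∈ Finset.range (d + 1),
      PowerSeries.coeff k (reducedSeries B) *
        (invCyclotomicThreeCoeff (d - k) * (Fintype.card F : ℂ) ^ (d - k)) := by
  have h : PowerSeries.mk (cubeFreeWeightedSum B) = reducedSeries B *
      PowerSeries.mk (fun m ↦ invCyclotomicThreeCoeff m * (Fintype.card F : ℂ) ^ m) := by
    rw [reducedSeries, mul_assoc, quadratic_mul_mk_invCyclotomicThreeCoeff, mul_one]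
  rw [← PowerSeries.coeff_mk d (cubeFreeWeightedSum B), h, PowerSeries.coeff_mul,
    Finset.Nat.sum_antidiagonal_eq_sum_range_succ_mk]
  simp only [PowerSeries.coeff_mk]

end GeneratingSeries

/-- The second assertion of Lemma 4.5 of the paper: there are constants `C₀, C₁, C₂ ∈ ℂ`
such that `W_d(B) = C_{d mod 3}·q^d + O_ε(q^{(1/2+ε)d})` for every `ε > 0`. -/
theorem cubefree_weighted_sum_asymptotic
    (Fq : Type*) [Field Fq] [Fintype Fq] [DecidableEq Fq]
    (B : Fq[X]) (hB : B ≠ 0) :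
    ∃ C : Fin 3 → ℂ, ∀ ε : ℝ, 0 < ε → ∃ Cε : ℝ, ∀ d : ℕ,
      ‖cubeFreeWeightedSum B d -
          C ⟨d % 3, Nat.mod_lt d (by norm_num)⟩ * (Fintype.card Fq : ℂ) ^ d‖ ≤
        Cε * (Fintype.card Fq : ℝ) ^ ((1 / 2 + ε) * d) := by
  refine ⟨fun i ↦ ∑' k, PowerSeries.coeff k (reducedSeries B) *
    ((Fintype.card Fq : ℂ)⁻¹ ^ k * invCyclotomicThreeCoeff (i + 2 * k)), fun ε hε ↦ ?_⟩
  set q : ℝ := (Fintype.card Fq : ℝ) with hqdef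
  have hq1 : 1 < q := Nat.one_lt_cast.mpr Fintype.one_lt_card
  have hq0 : 0 < q := by positivity
  set δ := min ε (1 / 2)
  have hδ : 0 < δ := by positivity
  have hδε : δ ≤ ε := min_le_left _ _
  have hδ2 : δ ≤ 1 / 2 := min_le_right _ _
  set R : ℝ := q ^ (-(1 / 2 + δ))
  have hR : 0 < R := Real.rpow_pos_of_pos hq0 _
  have hR1 : R ≤ 1 := Real.rpow_le_one_of_one_le_of_nonpos hq1.le (by linarith)
  have hqR2 : q * R ^ 2 < 1 := by
    have : q * R ^ 2 = q ^ (-(2 * δ)) := by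
      rw [← Real.rpow_natCast R, ← Real.rpow_mul hq0.le, ← Real.rpow_one_add' hq0.le]
      · congr 1
        push_cast
        ring
      · push_cast
        linarith
    rw [this]
    exact Real.rpow_lt_one_of_one_lt_of_neg hq1 (by linarith)
  have hqR : 1 ≤ q * R := by
    have : q * R = q ^ (1 / 2 - δ) := by
      nth_rewrite 1 [← Real.rpow_one q]
      rw [← Real.rpow_add hq0]
      congr 1
      ring
    rw [this]
    exact Real.one_le_rpow hq1.le (by linarith)
  have hsum := summable_norm_coeff_reducedSeries hB hR.le hR1 hqR2
  refine ⟨∑' k, ‖PowerSeries.coeff k (reducedSeries B)‖ * R ^ k, fun d ↦ ?_⟩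
  have hmain := norm_convolution_sub_le (c := invCyclotomicThreeCoeff)
    (fun n ↦ by
      rw [invCyclotomicThreeCoeff]
      split_ifs <;> simp)
    (fun n ↦ by simp [invCyclotomicThreeCoeff]) hR hq0 hqR hsum d
  rw [hqdef, Complex.ofReal_natCast, ← cubeFreeWeightedSum_eq_sum] at hmain
  refine hmain.trans (mul_le_mul_of_nonneg_left ?_ (tsum_nonneg fun _ ↦ by positivity))
  rw [← Real.rpow_neg hq0.le, neg_neg, Real.rpow_mul hq0.le, Real.rpow_natCast]
  gcongr
  exact hq1.le
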